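/- Let n ≥ 3, let U ⊆ ℝⁿ be open, let a : U → (symmetric invertible n×n real matrices) be smooth, and let b : U → ℝⁿ be a smooth nowhere-vanishing covector field that is closed (∂_i b_j = ∂_j b_i on U) and null with respect to a (Σ_{k,l} (a⁻¹)^{kl} b_k b_l = 0 on U). Then for every p ∈ U there exist an open neighbourhood V ⊆ U of p and a diffeomorphism φ from V onto an open subset of ℝⁿ such that, writing J = Dφ for the Jacobian and denoting the transformed metric by ã = (J⁻¹)ᵀ (a ∘ φ⁻¹) J⁻¹ and the transformed covector by b̃ = (J⁻¹)ᵀ (b ∘ φ⁻¹), one has: ã is in Kundt form for some smooth functions H, W_a, h_{ab}, and b̃_i = δ^u_i (i.e. b̃ = du). -/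

import Mathlib

open Matrix
open scoped BigOperators

noncomputable section

/-- Partial derivative of `f : ℝⁿ → ℝ` in the `i`-th coordinate direction at `p`. -/
def pd {n : ℕ} (i : Fin n) (f : (Fin n → ℝ) → ℝ) (p : Fin n → ℝ) : ℝ :=
  fderiv ℝ f p (Pi.single i 1)

/-- Christoffel symbols `Γ^k_{ij}` of a matrix field `a`. -/
def christoffel {n : ℕ} (a : (Fin n → ℝ) → Matrix (Fin n) (Fin n) ℝ)
    (k i j : Fin n) (p : Fin n → ℝ) : ℝ :=
  (1 / 2) * ∑ l, (a p)⁻¹ k l *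
    (pd i (fun q => a q j l) p + pd j (fun q => a q i l) p - pd l (fun q => a q i j) p)

/-- The coordinate index `u` (the first coordinate). -/
def uIdx {n : ℕ} (_hn : 3 ≤ n) : Fin n := ⟨0, by omega⟩

/-- The coordinate index `v` (the second coordinate). -/
def vIdx {n : ℕ} (_hn : 3 ≤ n) : Fin n := ⟨1, by omega⟩

/-- The embedding of the transverse indices `{3,…,n}` (zero-based: `{2,…,n-1}`). -/
def embIdx {n : ℕ} (i : Fin (n - 2)) : Fin n := ⟨(i : ℕ) + 2, by have := i.isLt; omega⟩

/-- A matrix is in Kundt form with data `H`, `W`, `h`. -/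
def IsKundt {n : ℕ} (hn : 3 ≤ n) (M : Matrix (Fin n) (Fin n) ℝ)
    (H : ℝ) (W : Fin n → ℝ) (h : Fin n → Fin n → ℝ) : Prop :=
  M (uIdx hn) (uIdx hn) = H ∧
  M (uIdx hn) (vIdx hn) = -1 ∧ M (vIdx hn) (uIdx hn) = -1 ∧ M (vIdx hn) (vIdx hn) = 0 ∧
  (∀ a : Fin n, 2 ≤ (a : ℕ) →
    M (uIdx hn) a = W a / 2 ∧ M a (uIdx hn) = W a / 2 ∧
    M (vIdx hn) a = 0 ∧ M a (vIdx hn) = 0) ∧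
  (∀ a b : Fin n, 2 ≤ (a : ℕ) → 2 ≤ (b : ℕ) → M a b = h a b)

/-- The affine Ricci tensor `R̄_{lk}` of a connection with coefficients `Γ^k_{ij}`. -/
def affineRicci {n : ℕ} (Γ : Fin n → Fin n → Fin n → (Fin n → ℝ) → ℝ)
    (l k : Fin n) (p : Fin n → ℝ) : ℝ :=
  (∑ i, pd i (Γ i k l) p) - pd k (fun q => ∑ i, Γ i i l q) p +
    ∑ i, ∑ m, (Γ i m i p * Γ m k l p - Γ i m k p * Γ m i l p)

open Set Metric
open scoped ContDiff Topology

section flow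
variable {E F : Type} [NormedAddCommGroup E] [NormedSpace ℝ E] [NormedAddCommGroup F]
  [NormedSpace ℝ F]

/-- Composition operator on continuous curves. -/
def nem {K : Type} [TopologicalSpace K] (f : E → F) (hf : Continuous f) (γ : C(K, E)) : C(K, F) :=
  (⟨f, hf⟩ : C(E, F)).comp γ

/-- Pointwise application of operators to curves. -/
noncomputable def bil (K : Type) [TopologicalSpace K] [CompactSpace K] :
    C(K, E →L[ℝ] F) →L[ℝ] C(K, E) →L[ℝ] C(K, F) :=
  LinearMap.mkContinuous₂
    (LinearMap.mk₂ ℝ (fun (A : C(K, E →L[ℝ] F)) (γ : C(K, E)) =>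
        (⟨fun t => A t (γ t), by fun_prop⟩ : C(K, F)))
      (by intros; ext; simp) (by intros; ext; simp) (by intros; ext; simp) (by intros; ext; simp))
    1 (by
      intro A γ
      rw [ContinuousMap.norm_le _ (by positivity)]
      intro t
      simp only [LinearMap.mk₂_apply, ContinuousMap.coe_mk, one_mul]
      exact (A t).le_opNorm_of_le (γ.norm_coe_le_norm t) |>.trans
        (by gcongr; exact A.norm_coe_le_norm t))

theorem nem_hasFDerivAt {K : Type} [TopologicalSpace K] [CompactSpace K] (f : E → F)
    (hf : ContDiff ℝ 1 f) (γ : C(K, E)) :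
    HasFDerivAt (nem f hf.continuous : C(K, E) → C(K, F))
      (bil K (nem (fderiv ℝ f) (hf.continuous_fderiv one_ne_zero) γ)) γ := by
  have hc : Continuous (nem (fderiv ℝ f) (hf.continuous_fderiv one_ne_zero) : C(K, E) → _) :=
    ContinuousMap.continuous_postcomp _
  rw [hasFDerivAt_iff_isLittleO_nhds_zero, Asymptotics.isLittleO_iff]
  intro ε hε
  obtain ⟨δ, hδ, H⟩ := Metric.continuous_iff.1 hc γ ε hε
  filter_upwards [Metric.ball_mem_nhds 0 hδ] with h hh
  rw [mem_ball_zero_iff] at hh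
  rw [ContinuousMap.norm_le _ (by positivity)]
  intro t
  have key := (convex_segment (γ t) (γ t + h t)).norm_image_sub_le_of_norm_hasFDerivWithin_le'
    (f := f) (f' := fderiv ℝ f) (φ := fderiv ℝ f (γ t)) (C := ε)
    (fun x _ => ((hf.differentiable one_ne_zero) x).hasFDerivAt.hasFDerivWithinAt)
    (by
      intro x hx
      rw [segment_eq_image'] at hx
      obtain ⟨s, hs, rfl⟩ := hx
      have h1 := H (γ + s • h) (by
        rw [dist_eq_norm, add_sub_cancel_left, norm_smul]
        refine lt_of_le_of_lt ?_ hh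
        rw [Real.norm_of_nonneg hs.1]
        exact mul_le_of_le_one_left (norm_nonneg _) hs.2)
      have h2 := (ContinuousMap.dist_apply_le_dist t).trans h1.le
      rw [dist_eq_norm] at h2
      simpa [nem] using h2)
    (left_mem_segment ℝ _ _) (right_mem_segment ℝ _ _)
  rw [add_sub_cancel_left] at key
  refine le_trans ?_ (key.trans (by gcongr; exact h.norm_coe_le_norm t))
  simp [nem, bil]

theorem nem_contDiff {K : Type} [TopologicalSpace K] [CompactSpace K] (k : ℕ) :
    ∀ {F : Type} [NormedAddCommGroup F] [NormedSpace ℝ F] (f : E → F)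
    (hf : ContDiff ℝ ∞ f), ContDiff ℝ k (nem f hf.continuous : C(K, E) → C(K, F)) := by
  induction k with
  | zero =>
    intro F _ _ f hf
    exact contDiff_zero.2 (ContinuousMap.continuous_postcomp _)
  | succ k ih =>
    intro F _ _ f hf
    have hf' : ContDiff ℝ ∞ (fderiv ℝ f) := hf.fderiv_right (by simp)
    rw [Nat.cast_succ, contDiff_succ_iff_hasFDerivAt]
    have hb : ContDiff ℝ k (fun A => bil (E := E) (F := F) K A) := ContinuousLinearMap.contDiff _
    exact ⟨fun γ => bil K (nem (fderiv ℝ f) hf'.continuous γ), hb.comp (ih (fderiv ℝ f) hf'), fun γ =>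
      nem_hasFDerivAt f (hf.of_le (by simp)) γ⟩

/-- Smooth inverse function theorem. -/
theorem smooth_inv [CompleteSpace E] (f : E → F) (U : Set E) (hU : IsOpen U)
    (hf : ContDiffOn ℝ ∞ f U) (p : E) (hp : p ∈ U) (f' : E ≃L[ℝ] F)
    (hf' : HasFDerivAt f (f' : E →L[ℝ] F) p) :
    ∃ e : OpenPartialHomeomorph E F, (e : E → F) = f ∧ p ∈ e.source ∧ e.source ⊆ U ∧
      ContDiffOn ℝ ∞ e.symm e.target ∧
      ∀ q ∈ e.source, ∃ g : E ≃L[ℝ] F, HasFDerivAt f (g : E →L[ℝ] F) q := by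
  have hp' : ContDiffAt ℝ ∞ f p := hf.contDiffAt (hU.mem_nhds hp)
  let e0 := hp'.toOpenPartialHomeomorph f hf' (by simp)
  have hcont : ContinuousOn (fderiv ℝ f) U := hf.continuousOn_fderiv_of_isOpen hU (by simp)
  let S : Set E := U ∩ fderiv ℝ f ⁻¹' (range ((↑) : (E ≃L[ℝ] F) → E →L[ℝ] F))
  have hS : IsOpen S := hcont.isOpen_inter_preimage hU ContinuousLinearEquiv.isOpen
  have hpS : p ∈ S := ⟨hp, f', hf'.fderiv.symm⟩
  have hder : ∀ q ∈ S, ∃ g : E ≃L[ℝ] F, HasFDerivAt f (g : E →L[ℝ] F) q := by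
    rintro q ⟨hq, g, hg⟩
    refine ⟨g, ?_⟩
    rw [hg]
    exact ((hf.contDiffAt (hU.mem_nhds hq)).differentiableAt (by simp)).hasFDerivAt
  refine ⟨e0.restrOpen S hS, rfl, ?_, ?_, ?_, ?_⟩
  · exact ⟨hp'.mem_toOpenPartialHomeomorph_source hf' (by simp), hpS⟩
  · exact fun q hq => hq.2.1
  · intro y hy
    have hm := (e0.restrOpen S hS).map_target hy
    obtain ⟨g, hg⟩ := hder _ hm.2
    exact ((e0.restrOpen S hS).contDiffAt_symm hy hg
      (hf.contDiffAt (hU.mem_nhds hm.2.1))).contDiffWithinAt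
  · exact fun q hq => hder q hq.2

/-- The compact time interval. -/
abbrev KK : Type := Icc (-1 : ℝ) 1

/-- The integration operator on curves. -/
noncomputable def intOp [CompleteSpace E] : C(KK, E) →L[ℝ] C(KK, E) :=
  LinearMap.mkContinuous
    { toFun := fun γ => ⟨fun t => ∫ τ in (0 : ℝ)..t, γ (projIcc (-1) 1 (by norm_num) τ), by
        have h : Continuous (fun τ => γ (projIcc (-1) 1 (by norm_num) τ)) :=
          γ.continuous.comp continuous_projIcc
        exact (intervalIntegral.continuous_primitive (fun a b => h.intervalIntegrable a b) 0).comp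
          continuous_subtype_val⟩
      map_add' := by
        intro γ η
        ext t
        have h : ∀ γ : C(KK, E), Continuous (fun τ => γ (projIcc (-1) 1 (by norm_num) τ)) :=
          fun γ => γ.continuous.comp continuous_projIcc
        simp only [ContinuousMap.add_apply, ContinuousMap.coe_mk]
        exact intervalIntegral.integral_add ((h γ).intervalIntegrable _ _)
          ((h η).intervalIntegrable _ _)
      map_smul' := by
        intro c γ
        ext t
        simp }
    1 (by
      intro γ
      rw [ContinuousMap.norm_le _ (by positivity)]
      intro t
      simp only [LinearMap.coe_mk, AddHom.coe_mk, ContinuousMap.coe_mk, one_mul]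
      refine (intervalIntegral.norm_integral_le_of_norm_le_const
        (fun x _ => γ.norm_coe_le_norm _)).trans ?_
      rw [sub_zero]
      exact mul_le_of_le_one_right (norm_nonneg _) (abs_le.2 t.2))

theorem intOp_apply [CompleteSpace E] (γ : C(KK, E)) (t : KK) :
    intOp γ t = ∫ τ in (0 : ℝ)..t, γ (projIcc (-1) 1 (by norm_num) τ) := rfl

/-- Constant curves. -/
noncomputable def cst : E →L[ℝ] C(KK, E) :=
  LinearMap.mkContinuous
    { toFun := fun x => ContinuousMap.const KK x
      map_add' := by intros; rfl
      map_smul' := by intros; rfl } 1 (by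
      intro x
      rw [ContinuousMap.norm_le _ (by positivity)]
      intro t
      rw [one_mul]
      exact le_refl _)

theorem cst_apply (x : E) (t : KK) : cst x t = x := rfl

/-- The map whose zeros (in the last component) are the rescaled integral curves. -/
noncomputable def flowMap [CompleteSpace E] (X : E → E) (hX : Continuous X)
    (z : ℝ × E × C(KK, E)) : ℝ × E × C(KK, E) :=
  (z.1, z.2.1, z.2.2 - cst z.2.1 - z.1 • intOp (nem X hX z.2.2))

/-- The derivative of `flowMap` at the base point. -/
noncomputable def flowDer (v : C(KK, E)) :
    (ℝ × E × C(KK, E)) ≃L[ℝ] (ℝ × E × C(KK, E)) :=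
  ContinuousLinearEquiv.equivOfInverse
    ((ContinuousLinearMap.fst ℝ ℝ (E × C(KK, E))).prod
      (((ContinuousLinearMap.fst ℝ E C(KK, E)).comp (ContinuousLinearMap.snd ℝ ℝ (E × C(KK, E)))).prod
      (((ContinuousLinearMap.snd ℝ E C(KK, E)).comp (ContinuousLinearMap.snd ℝ ℝ (E × C(KK, E)))) -
        cst.comp ((ContinuousLinearMap.fst ℝ E C(KK, E)).comp
          (ContinuousLinearMap.snd ℝ ℝ (E × C(KK, E)))) -
        (ContinuousLinearMap.fst ℝ ℝ (E × C(KK, E))).smulRight v)))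
    ((ContinuousLinearMap.fst ℝ ℝ (E × C(KK, E))).prod
      (((ContinuousLinearMap.fst ℝ E C(KK, E)).comp (ContinuousLinearMap.snd ℝ ℝ (E × C(KK, E)))).prod
      (((ContinuousLinearMap.snd ℝ E C(KK, E)).comp (ContinuousLinearMap.snd ℝ ℝ (E × C(KK, E)))) +
        cst.comp ((ContinuousLinearMap.fst ℝ E C(KK, E)).comp
          (ContinuousLinearMap.snd ℝ ℝ (E × C(KK, E)))) +
        (ContinuousLinearMap.fst ℝ ℝ (E × C(KK, E))).smulRight v)))
    (by rintro ⟨s, x, γ⟩; simp; abel) (by rintro ⟨s, x, γ⟩; simp; abel)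

theorem flowDer_apply (v : C(KK, E)) (z : ℝ × E × C(KK, E)) :
    flowDer v z = (z.1, z.2.1, z.2.2 - cst z.2.1 - z.1 • v) := rfl

theorem flowMap_contDiff [CompleteSpace E] (X : E → E) (hX : ContDiff ℝ ∞ X) :
    ContDiff ℝ ∞ (flowMap X hX.continuous) := by
  have h1 : ContDiff ℝ ∞ (nem X hX.continuous : C(KK, E) → C(KK, E)) :=
    contDiff_infty.2 fun k => nem_contDiff k X hX
  have h2 : ContDiff ℝ ∞ (fun z : ℝ × E × C(KK, E) => nem X hX.continuous z.2.2) :=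
    h1.comp (contDiff_snd.comp contDiff_snd)
  unfold flowMap
  have h3 : ContDiff ℝ ∞ (fun z : ℝ × E × C(KK, E) => intOp (nem X hX.continuous z.2.2)) :=
    (intOp (E := E)).contDiff.comp h2
  have h4 : ContDiff ℝ ∞ (fun z : ℝ × E × C(KK, E) => (cst z.2.1 : C(KK, E))) :=
    (cst (E := E)).contDiff.comp (contDiff_fst.comp contDiff_snd)
  exact contDiff_fst.prodMk ((contDiff_fst.comp contDiff_snd).prodMk
    (((contDiff_snd.comp contDiff_snd).sub h4).sub (contDiff_fst.smul h3)))

theorem flowMap_hasFDerivAt [CompleteSpace E] (X : E → E) (hX : ContDiff ℝ ∞ X) (x₀ : E) :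
    HasFDerivAt (flowMap X hX.continuous)
      (flowDer (intOp (nem X hX.continuous (cst x₀))) : _ →L[ℝ] (ℝ × E × C(KK, E)))
      (0, x₀, cst x₀) := by
  have h1 : ContDiff ℝ ∞ (nem X hX.continuous : C(KK, E) → C(KK, E)) :=
    contDiff_infty.2 fun k => nem_contDiff k X hX
  have h2 : ContDiff ℝ ∞ (fun z : ℝ × E × C(KK, E) => intOp (nem X hX.continuous z.2.2)) :=
    (intOp (E := E)).contDiff.comp (h1.comp (contDiff_snd.comp contDiff_snd))
  have h3 := (h2.differentiable (by simp) (0, x₀, cst x₀)).hasFDerivAt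
  have hs : HasFDerivAt (fun z : ℝ × E × C(KK, E) => z.1) _ (0, x₀, cst x₀) :=
    hasFDerivAt_fst (𝕜 := ℝ)
  have hx : HasFDerivAt (fun z : ℝ × E × C(KK, E) => z.2.1) _ (0, x₀, cst x₀) :=
    hasFDerivAt_fst.comp (0, x₀, cst x₀) (hasFDerivAt_snd (𝕜 := ℝ) (E := ℝ) (F := E × C(KK, E)))
  have hg : HasFDerivAt (fun z : ℝ × E × C(KK, E) => z.2.2) _ (0, x₀, cst x₀) :=
    hasFDerivAt_snd.comp (0, x₀, cst x₀) (hasFDerivAt_snd (𝕜 := ℝ) (E := ℝ) (F := E × C(KK, E)))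
  have hc : HasFDerivAt (fun z : ℝ × E × C(KK, E) => (cst z.2.1 : C(KK, E))) _ (0, x₀, cst x₀) :=
    (cst (E := E)).hasFDerivAt.comp (0, x₀, cst x₀) hx
  have key := hs.prodMk (hx.prodMk ((hg.sub hc).sub (hs.smul h3)))
  refine HasFDerivAt.congr_fderiv key ?_
  refine ContinuousLinearMap.ext fun z => ?_
  simp only [ContinuousLinearEquiv.coe_coe, flowDer_apply]
  simp

theorem intOp_scale [CompleteSpace E] (γ : C(KK, E)) (m : C(KK, KK)) (l : ℝ) (hl : l ∈ Icc (-1:ℝ) 1)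
    (hm : ∀ t : KK, (m t : ℝ) = l * t) (t : KK) :
    intOp γ (m t) = l • intOp (γ.comp m) t := by
  rw [intOp_apply, intOp_apply, hm]
  have hn : (-1 : ℝ) ≤ 1 := by norm_num
  have : (l * (t : ℝ)) = l * t := rfl
  have h0 : (0 : ℝ) = l * 0 := by simp
  conv_lhs => rw [h0]
  rw [← intervalIntegral.smul_integral_comp_mul_left]
  congr 1
  apply intervalIntegral.integral_congr
  intro τ hτ
  have hτ' : τ ∈ Icc (-1 : ℝ) 1 := by
    have : uIcc (0 : ℝ) t ⊆ Icc (-1 : ℝ) 1 :=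
      uIcc_subset_Icc ⟨by norm_num, by norm_num⟩ t.2
    exact this hτ
  have hlt : l * τ ∈ Icc (-1 : ℝ) 1 := by
    have h1 := abs_le.2 hl
    have h2 := abs_le.2 hτ'
    refine abs_le.1 ?_
    rw [abs_mul]
    exact mul_le_one₀ h1 (abs_nonneg _) h2
  simp only [ContinuousMap.comp_apply]
  congr 1
  ext
  rw [hm, projIcc_of_mem hn hτ', projIcc_of_mem hn hlt]

/-- Local smooth flow of a smooth vector field. -/
theorem local_flow [CompleteSpace E] (X : E → E) (hX : ContDiff ℝ ∞ X) (x₀ : E) :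
    ∃ (F : ℝ × E → E) (r : ℝ), 0 < r ∧ ContDiffOn ℝ ∞ F (ball (0, x₀) r) ∧
      (∀ x ∈ ball x₀ r, F (0, x) = x) ∧
      ∀ s x, |s| < r → x ∈ ball x₀ r → HasDerivAt (fun s => F (s, x)) (X (F (s, x))) s := by
  obtain ⟨e, he, hpe, -, hsymm, -⟩ := smooth_inv (flowMap X hX.continuous) univ isOpen_univ
    (flowMap_contDiff X hX).contDiffOn (0, x₀, cst x₀) (mem_univ _) _ (flowMap_hasFDerivAt X hX x₀)
  have hn : (-1 : ℝ) ≤ 1 := by norm_num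
  have hbase : e (0, x₀, cst x₀) = (0, x₀, 0) := by
    rw [he]; simp [flowMap]
  obtain ⟨ρ, hρ, hball⟩ := Metric.isOpen_iff.1 e.open_source _ hpe
  have htar : ((0 : ℝ), x₀, (0 : C(KK, E))) ∈ e.target := by
    rw [← hbase]; exact e.map_source hpe
  let emb : ℝ × E → ℝ × E × C(KK, E) := fun z => (z.1, z.2, 0)
  have hemb : ContDiff ℝ ∞ emb := contDiff_fst.prodMk (contDiff_snd.prodMk contDiff_const)
  have hopen : emb ⁻¹' (e.target ∩ e.symm ⁻¹' ball (0, x₀, cst x₀) ρ) ∈ 𝓝 ((0 : ℝ), x₀) := by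
    refine (hemb.continuous.isOpen_preimage _
      (e.symm.isOpen_inter_preimage isOpen_ball)).mem_nhds ?_
    refine ⟨htar, ?_⟩
    have : e.symm (0, x₀, 0) = (0, x₀, cst x₀) := by rw [← hbase, e.left_inv hpe]
    simp only [mem_preimage, emb]
    rw [this]
    exact mem_ball_self hρ
  obtain ⟨r, hr, hrs⟩ := Metric.mem_nhds_iff.1 hopen
  let G : ℝ × E → C(KK, E) := fun z => (e.symm (emb z)).2.2
  have hGs : ∀ z ∈ ball ((0 : ℝ), x₀) r, e.symm (emb z) = (z.1, z.2, G z) ∧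
      G z = cst z.2 + z.1 • intOp (nem X hX.continuous (G z)) ∧
      (z.1, z.2, G z) ∈ ball ((0 : ℝ), x₀, cst x₀) ρ := by
    intro z hz
    have hz' := hrs hz
    have h1 : e (e.symm (emb z)) = emb z := e.right_inv hz'.1
    rw [he] at h1
    simp only [flowMap, emb, Prod.mk.injEq] at h1
    obtain ⟨ha, hb, hc⟩ := h1
    have h2 : e.symm (emb z) = (z.1, z.2, G z) := Prod.ext ha (Prod.ext hb rfl)
    refine ⟨h2, ?_, ?_⟩
    · rw [ha, hb, sub_sub, sub_eq_zero] at hc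
      exact hc
    · rw [← h2]; exact hz'.2
  have huniq : ∀ z ∈ ball ((0 : ℝ), x₀) r, ∀ γ : C(KK, E),
      (z.1, z.2, γ) ∈ ball ((0 : ℝ), x₀, cst x₀) ρ →
      γ = cst z.2 + z.1 • intOp (nem X hX.continuous γ) → γ = G z := by
    intro z hz γ hγ heq
    have h1 : e (z.1, z.2, γ) = emb z := by
      rw [he]
      simp only [flowMap, emb, Prod.mk.injEq, true_and]
      rw [sub_sub, sub_eq_zero]; exact heq
    have h2 := e.left_inv (hball hγ)
    rw [h1, (hGs z hz).1] at h2
    simpa using h2.symm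
  let one : KK := ⟨1, by norm_num, le_refl _⟩
  have hGsm : ContDiffOn ℝ ∞ G (ball (0, x₀) r) := by
    have h := hsymm.comp hemb.contDiffOn (s := ball ((0 : ℝ), x₀) r) (fun z hz => (hrs hz).1)
    exact contDiff_snd.comp_contDiffOn (contDiff_snd.comp_contDiffOn h)
  have hscale : ∀ z ∈ ball ((0 : ℝ), x₀) r, ∀ l : KK, G ((l : ℝ) * z.1, z.2) one = G z l := by
    intro z hz l
    have hl1 : |(l : ℝ)| ≤ 1 := abs_le.2 l.2
    let m : C(KK, KK) := ⟨fun t => ⟨l * t, by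
      have h2 := abs_le.2 t.2
      refine abs_le.1 ?_
      rw [abs_mul]
      exact mul_le_one₀ hl1 (abs_nonneg _) h2⟩, by fun_prop⟩
    have hle : |(l : ℝ) * z.1| ≤ |z.1| := by
      rw [abs_mul]; exact mul_le_of_le_one_left (abs_nonneg _) hl1
    have hz2 : ((l : ℝ) * z.1, z.2) ∈ ball ((0 : ℝ), x₀) r := by
      rw [← ball_prod_same, mem_prod, mem_ball_zero_iff, Real.norm_eq_abs] at hz ⊢
      exact ⟨hle.trans_lt hz.1, hz.2⟩
    obtain ⟨-, hG2, hG3⟩ := hGs z hz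
    have := huniq ((l : ℝ) * z.1, z.2) hz2 ((G z).comp m) (by
        rw [← ball_prod_same, mem_prod, mem_ball_zero_iff, Real.norm_eq_abs, ← ball_prod_same,
          mem_prod] at hG3 ⊢
        refine ⟨hle.trans_lt hG3.1, hG3.2.1, ?_⟩
        have h4 := hG3.2.2
        simp only [mem_ball] at h4 ⊢
        refine lt_of_le_of_lt ?_ h4
        rw [ContinuousMap.dist_le dist_nonneg]
        intro t
        exact ContinuousMap.dist_apply_le_dist (f := G z) (g := cst x₀) (m t)) (by
        ext t
        have h5 := congrArg (fun γ : C(KK, E) => γ (m t)) hG2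
        simp only [ContinuousMap.add_apply, ContinuousMap.smul_apply, cst_apply] at h5
        rw [intOp_scale _ m l l.2 (fun t => rfl)] at h5
        simp only [ContinuousMap.add_apply, ContinuousMap.smul_apply, cst_apply,
          ContinuousMap.comp_apply]
        rw [h5, smul_smul, mul_comm z.1]
        rfl)
    rw [← this]
    simp only [ContinuousMap.comp_apply]
    congr 1
    ext
    simp [m, one]
  refine ⟨fun z => G z one, r / 2, by positivity, ?_, ?_, ?_⟩
  · exact (ContinuousMap.evalCLM ℝ one).contDiff.comp_contDiffOn
      (hGsm.mono (ball_subset_ball (half_le_self hr.le)))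
  · intro x hx
    have hz : ((0 : ℝ), x) ∈ ball ((0 : ℝ), x₀) r := by
      rw [← ball_prod_same]
      exact ⟨mem_ball_self hr, ball_subset_ball (by linarith) hx⟩
    have := (hGs _ hz).2.1
    simp only [zero_smul, add_zero] at this
    simp only [this, cst_apply]
  · intro s x hs hx
    have h2 : (0 : ℝ) < r / 2 := by positivity
    have hz : (r / 2, x) ∈ ball ((0 : ℝ), x₀) r := by
      rw [← ball_prod_same]
      refine ⟨?_, ball_subset_ball (by linarith) hx⟩
      rw [mem_ball_zero_iff, Real.norm_of_nonneg h2.le]; linarith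
    set γ := G (r / 2, x) with hγ
    have hmem : ∀ σ : ℝ, |σ| < r / 2 → |σ / (r / 2)| < 1 := by
      intro σ hσ
      rw [abs_div, abs_of_pos h2, div_lt_one h2]; exact hσ
    have hmem' : ∀ σ : ℝ, |σ| < r / 2 → σ / (r / 2) ∈ Icc (-1 : ℝ) 1 := fun σ hσ =>
      abs_le.1 (hmem σ hσ).le
    have hF : ∀ σ : ℝ, |σ| < r / 2 → G (σ, x) one = γ (projIcc (-1) 1 hn (σ / (r / 2))) := by
      intro σ hσ
      have := hscale _ hz (projIcc (-1) 1 hn (σ / (r / 2)))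
      rw [← hγ, projIcc_of_mem hn (hmem' σ hσ)] at this
      simp only at this
      rw [div_mul_cancel₀ _ h2.ne'] at this
      rw [this, projIcc_of_mem hn (hmem' σ hσ)]
    have hF2 : ∀ σ : ℝ, |σ| < r / 2 → G (σ, x) one = x + (r / 2) • ∫ τ in (0 : ℝ)..(σ / (r / 2)),
        X (γ (projIcc (-1) 1 hn τ)) := by
      intro σ hσ
      rw [hF σ hσ]
      have h5 := congrArg (fun γ : C(KK, E) => γ (projIcc (-1) 1 hn (σ / (r / 2)))) (hGs _ hz).2.1
      simp only [ContinuousMap.add_apply, ContinuousMap.smul_apply, cst_apply, intOp_apply,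
        ← hγ] at h5
      rw [h5, projIcc_of_mem hn (hmem' σ hσ)]
      rfl
    have hcont : Continuous (fun τ => X (γ (projIcc (-1) 1 hn τ))) :=
      hX.continuous.comp (γ.continuous.comp continuous_projIcc)
    have hd := intervalIntegral.integral_hasDerivAt_right
      (hcont.intervalIntegrable (0 : ℝ) (s / (r / 2)))
      (hcont.stronglyMeasurableAtFilter _ _) hcont.continuousAt
    have hdiv : HasDerivAt (fun σ : ℝ => σ / (r / 2)) (1 / (r / 2)) s :=
      (hasDerivAt_id s).div_const _
    have h6 := ((hd.scomp s hdiv).const_smul (r / 2)).const_add x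
    rw [smul_smul, mul_one_div_cancel h2.ne', one_smul, ← hF s hs] at h6
    refine h6.congr_of_eventuallyEq ?_
    have : ∀ᶠ σ in 𝓝 s, |σ| < r / 2 := (continuous_abs.tendsto s).eventually (gt_mem_nhds hs)
    filter_upwards [this] with σ hσ
    rw [hF2 σ hσ]
    rfl
end flow

theorem exists_adapted {n : ℕ} (u v : Fin n) (huv : u ≠ v) (β : (Fin n → ℝ) →L[ℝ] ℝ) (hβ : β ≠ 0)
    (X : Fin n → ℝ) (hX : X ≠ 0) (hβX : β X = 0) :
    ∃ M : (Fin n → ℝ) ≃L[ℝ] (Fin n → ℝ), M X = Pi.single v 1 ∧ ∀ z, M z u = β z := by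
  let pu : (Fin n → ℝ) →L[ℝ] ℝ := ContinuousLinearMap.proj u
  have hpu : pu ≠ 0 := by
    intro h
    have := congrArg (fun l => l (Pi.single u (1 : ℝ))) h
    simp [pu] at this
  have hrk : ∀ l : (Fin n → ℝ) →L[ℝ] ℝ, l ≠ 0 →
      Module.finrank ℝ (LinearMap.ker (l : (Fin n → ℝ) →ₗ[ℝ] ℝ)) + 1 = n := by
    intro l hl
    have := Module.Dual.finrank_ker_add_one_of_ne_zero (K := ℝ) (V₁ := Fin n → ℝ)
      (f := (l : (Fin n → ℝ) →ₗ[ℝ] ℝ)) (by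
        intro h; exact hl (ContinuousLinearMap.coe_injective h))
    simpa using this
  have hfr : Module.finrank ℝ (LinearMap.ker (β : (Fin n → ℝ) →ₗ[ℝ] ℝ)) =
      Module.finrank ℝ (LinearMap.ker (pu : (Fin n → ℝ) →ₗ[ℝ] ℝ)) := by
    have h1 := hrk β hβ
    have h2 := hrk pu hpu
    omega
  let g0 := LinearEquiv.ofFinrankEq _ _ hfr
  let X' : LinearMap.ker (β : (Fin n → ℝ) →ₗ[ℝ] ℝ) := ⟨X, by simpa using hβX⟩
  have hX' : X' ≠ 0 := by
    intro h; exact hX (congrArg Subtype.val h)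
  let ev : LinearMap.ker (pu : (Fin n → ℝ) →ₗ[ℝ] ℝ) := ⟨Pi.single v 1, by simp [pu, huv]⟩
  have hev : ev ≠ 0 := by
    intro h
    have := congrFun (congrArg Subtype.val h) v
    simp [ev] at this
  obtain ⟨A, hA⟩ := SeparatingDual.exists_continuousLinearEquiv_apply_eq (R := ℝ)
    (x := g0 X') (y := ev) (by simpa using hX') hev
  obtain ⟨w, hw⟩ : ∃ w, β w = 1 := by
    obtain ⟨w, hw⟩ : ∃ w, β w ≠ 0 := by
      by_contra! h
      exact hβ (ContinuousLinearMap.ext h)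
    exact ⟨(β w)⁻¹ • w, by simp [hw]⟩
  let P : (Fin n → ℝ) →ₗ[ℝ] LinearMap.ker (β : (Fin n → ℝ) →ₗ[ℝ] ℝ) :=
    LinearMap.codRestrict _ (LinearMap.id - (β : (Fin n → ℝ) →ₗ[ℝ] ℝ).smulRight w)
      (by intro z; simp [hw])
  let M0 : (Fin n → ℝ) →ₗ[ℝ] (Fin n → ℝ) :=
    (Submodule.subtype _ ∘ₗ A.toLinearEquiv.toLinearMap ∘ₗ g0.toLinearMap ∘ₗ P) +
      (β : (Fin n → ℝ) →ₗ[ℝ] ℝ).smulRight (Pi.single u 1)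
  have hM0 : ∀ z, M0 z = (A (g0 (P z)) : Fin n → ℝ) + β z • Pi.single u 1 := fun z => rfl
  have hM0u : ∀ z, M0 z u = β z := by
    intro z
    have h1 : pu (A (g0 (P z)) : Fin n → ℝ) = 0 := (A (g0 (P z))).2
    have h2 : (A (g0 (P z)) : Fin n → ℝ) u = 0 := h1
    rw [hM0]
    simp [h2]
  have hP : ∀ z, β z = 0 → ((P z : Fin n → ℝ)) = z := by
    intro z hz
    change z - β z • w = z
    rw [hz, zero_smul, sub_zero]
  have hinj : Function.Injective M0 := by
    rw [← LinearMap.ker_eq_bot, LinearMap.ker_eq_bot']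
    intro z hz
    have h1 : β z = 0 := by rw [← hM0u, hz]; rfl
    rw [hM0, h1, zero_smul, add_zero] at hz
    have h2 : P z = 0 := by
      have : A (g0 (P z)) = 0 := Subtype.ext hz
      simpa using this
    rw [← hP z h1, h2]; rfl
  refine ⟨(LinearEquiv.ofInjectiveEndo M0 hinj).toContinuousLinearEquiv, ?_, hM0u⟩
  change M0 X = _
  rw [hM0, hβX, zero_smul, add_zero]
  have : P X = X' := Subtype.ext (hP X hβX)
  rw [this, hA]

theorem globalize {E : Type} [NormedAddCommGroup E] [NormedSpace ℝ E] [FiniteDimensional ℝ E]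
    (X : E → E) (U : Set E) (hU : IsOpen U) (hX : ContDiffOn ℝ ∞ X U) (p : E) (hp : p ∈ U) :
    ∃ (Y : E → E) (W : Set E), ContDiff ℝ ∞ Y ∧ IsOpen W ∧ p ∈ W ∧ W ⊆ U ∧ ∀ q ∈ W, Y q = X q := by
  obtain ⟨ε, hε, hball⟩ := Metric.isOpen_iff.1 hU p hp
  let f : ContDiffBump p := ⟨ε / 4, ε / 2, by positivity, by linarith⟩
  refine ⟨fun q => f q • X q, ball p (ε / 4), ?_, isOpen_ball, mem_ball_self (by positivity),
    (ball_subset_ball (by linarith)).trans hball, ?_⟩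
  · rw [contDiff_iff_contDiffAt]
    intro q
    by_cases hq : q ∈ U
    · exact f.contDiffAt.smul (hX.contDiffAt (hU.mem_nhds hq))
    · have hq' : q ∉ tsupport f := by
        intro h
        rw [f.tsupport_eq] at h
        exact hq (hball (closedBall_subset_ball (by change ε / 2 < ε; linarith) h))
      have h0 : (fun q => f q • X q) =ᶠ[𝓝 q] fun _ => 0 := by
        filter_upwards [notMem_tsupport_iff_eventuallyEq.1 hq'] with y hy
        simp [hy]
      exact contDiffAt_const.congr_of_eventuallyEq h0
  · intro q hq
    simp only
    rw [f.one_of_mem_closedBall (ball_subset_closedBall hq), one_smul]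

/-- Flow box coordinates with prescribed linear part. -/
theorem flow_box {n : ℕ} (v : Fin n) (X : (Fin n → ℝ) → (Fin n → ℝ)) (U : Set (Fin n → ℝ))
    (hU : IsOpen U) (hX : ContDiffOn ℝ ∞ X U) (p : Fin n → ℝ) (hp : p ∈ U)
    (M : (Fin n → ℝ) ≃L[ℝ] (Fin n → ℝ)) (hM : M (X p) = Pi.single v 1) :
    ∃ (χ : (Fin n → ℝ) → (Fin n → ℝ)) (W : Set (Fin n → ℝ)), IsOpen W ∧ p ∈ W ∧ W ⊆ U ∧
      ContDiffOn ℝ ∞ χ W ∧ HasFDerivAt χ (M : (Fin n → ℝ) →L[ℝ] (Fin n → ℝ)) p ∧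
      ∀ q ∈ W, fderiv ℝ χ q (X q) = Pi.single v 1 := by
  obtain ⟨Y, W₀, hY, hW₀, hpW₀, hW₀U, hYX⟩ := globalize X U hU hX p hp
  obtain ⟨F, r, hr, hF, hF0, hFs⟩ := local_flow Y hY p
  let L : (Fin n → ℝ) →L[ℝ] (Fin n → ℝ) := M.symm
  let pv : (Fin n → ℝ) →L[ℝ] ℝ := ContinuousLinearMap.proj v
  let D : (Fin n → ℝ) →L[ℝ] ℝ × (Fin n → ℝ) :=
    pv.prod (L.comp (ContinuousLinearMap.id ℝ _ - pv.smulRight (Pi.single v 1)))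
  let A : (Fin n → ℝ) → ℝ × (Fin n → ℝ) := fun z => D z + (0, p)
  have hAsm : ContDiff ℝ ∞ A := D.contDiff.add contDiff_const
  have hA0 : A 0 = (0, p) := by simp [A]
  have hAd : ∀ z, HasFDerivAt A D z := fun z => D.hasFDerivAt.add_const _
  have hDv : D (Pi.single v 1) = (1, 0) := by
    simp [D, pv]
  let S : Set (Fin n → ℝ) := A ⁻¹' ball (0, p) r
  have hS : IsOpen S := isOpen_ball.preimage hAsm.continuous
  have h0S : (0 : Fin n → ℝ) ∈ S := by
    change A 0 ∈ ball ((0 : ℝ), p) r; rw [hA0]; exact mem_ball_self hr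
  let ψ : (Fin n → ℝ) → (Fin n → ℝ) := fun z => F (A z)
  have hψ : ContDiffOn ℝ ∞ ψ S := hF.comp hAsm.contDiffOn (fun z hz => hz)
  have hψ0 : ψ 0 = p := by
    change F (A 0) = p
    rw [hA0, hF0 p (mem_ball_self hr)]
  have hFd : ∀ y ∈ ball ((0 : ℝ), p) r, HasFDerivAt F (fderiv ℝ F y) y := fun y hy =>
    ((hF.contDiffAt (isOpen_ball.mem_nhds hy)).differentiableAt (by simp)).hasFDerivAt
  have hFv : ∀ y ∈ ball ((0 : ℝ), p) r, fderiv ℝ F y (1, 0) = Y (F y) := by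
    rintro ⟨s, x⟩ hy
    have hy' := hy
    rw [← ball_prod_same, mem_prod, mem_ball_zero_iff, Real.norm_eq_abs] at hy'
    have h1 : HasDerivAt (fun σ : ℝ => (σ, x)) ((1 : ℝ), (0 : Fin n → ℝ)) s :=
      (hasDerivAt_id s).prodMk (hasDerivAt_const s x)
    have h2 := (hFd _ hy).comp_hasDerivAt s h1
    exact h2.unique (hFs s x hy'.1 hy'.2)
  have hFx : ∀ h, fderiv ℝ F (0, p) (0, h) = h := by
    intro h
    have hy : ((0 : ℝ), p) ∈ ball ((0 : ℝ), p) r := mem_ball_self hr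
    have h1 : HasFDerivAt (fun x : Fin n → ℝ => ((0 : ℝ), x))
        (ContinuousLinearMap.inr ℝ ℝ (Fin n → ℝ)) p :=
      (ContinuousLinearMap.inr ℝ ℝ (Fin n → ℝ)).hasFDerivAt
    have h2 := (hFd _ hy).comp p h1
    have h3 : (F ∘ fun x : Fin n → ℝ => ((0 : ℝ), x)) =ᶠ[𝓝 p] id := by
      filter_upwards [ball_mem_nhds p hr] with x hx
      exact hF0 x hx
    have h4 := (hasFDerivAt_id (𝕜 := ℝ) p).congr_of_eventuallyEq h3
    have h5 := h2.unique h4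
    have := congrArg (fun l : (Fin n → ℝ) →L[ℝ] (Fin n → ℝ) => l h) h5
    simpa using this
  have hψd : ∀ z ∈ S, HasFDerivAt ψ ((fderiv ℝ F (A z)).comp D) z := fun z hz =>
    (hFd _ hz).comp z (hAd z)
  have hψv : ∀ z ∈ S, fderiv ℝ ψ z (Pi.single v 1) = Y (ψ z) := by
    intro z hz
    rw [(hψd z hz).fderiv, ContinuousLinearMap.comp_apply, hDv, hFv _ hz]
  have hψd0 : HasFDerivAt ψ (M.symm : (Fin n → ℝ) →L[ℝ] (Fin n → ℝ)) 0 := by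
    refine (hψd 0 h0S).congr_fderiv ?_
    refine ContinuousLinearMap.ext fun z => ?_
    have hD : D z = z v • ((1 : ℝ), (0 : Fin n → ℝ)) + (0, L z - z v • X p) := by
      have : L (Pi.single v 1) = X p := by
        rw [← hM]; exact M.symm_apply_apply _
      refine Prod.ext ?_ ?_
      · simp [D, pv]
      · simp [D, pv, this]
    have hYp : Y p = X p := hYX p hpW₀
    rw [ContinuousLinearMap.comp_apply, hD, map_add, map_smul, hA0, hFx,
      hFv _ (mem_ball_self hr), hF0 p (mem_ball_self hr), hYp]
    simp [L]
  let S' := S ∩ ψ ⁻¹' W₀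
  have hS' : IsOpen S' := hψ.continuousOn.isOpen_inter_preimage hS hW₀
  obtain ⟨e, he, h0e, heS, hesm, hed⟩ := smooth_inv ψ S' hS' (hψ.mono inter_subset_left) 0
    ⟨h0S, by change ψ 0 ∈ W₀; rw [hψ0]; exact hpW₀⟩ M.symm hψd0
  have hpt : p ∈ e.target := by
    have := e.map_source h0e
    rwa [he, hψ0] at this
  have hmap : ∀ q ∈ e.target, ψ (e.symm q) = q := fun q hq => by
    rw [← he]; exact e.right_inv hq
  have hdinv : ∀ q ∈ e.target, ∀ g : (Fin n → ℝ) ≃L[ℝ] (Fin n → ℝ),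
      HasFDerivAt ψ (g : (Fin n → ℝ) →L[ℝ] (Fin n → ℝ)) (e.symm q) →
      HasFDerivAt e.symm (g.symm : (Fin n → ℝ) →L[ℝ] (Fin n → ℝ)) q := by
    intro q hq g hg
    exact e.hasFDerivAt_symm hq (by rw [he]; exact hg)
  have hsub : e.target ⊆ W₀ := fun q hq => by
    have := (heS (e.map_target hq)).2
    rwa [mem_preimage, hmap q hq] at this
  refine ⟨e.symm, e.target, e.open_target, hpt, hsub.trans hW₀U, hesm, ?_, ?_⟩
  · have h0 : e.symm p = 0 := by
      have := e.left_inv h0e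
      rwa [he, hψ0] at this
    exact hdinv p hpt M.symm (by rw [h0]; exact hψd0)
  · intro q hq
    have hm := e.map_target hq
    obtain ⟨g, hg⟩ := hed _ hm
    rw [(hdinv q hq g hg).fderiv]
    have h1 := hψv _ (heS hm).1
    rw [hg.fderiv, hmap q hq, hYX q (hsub hq)] at h1
    rw [← h1]
    simp

theorem det_smooth {m : ℕ} {E : Type} [NormedAddCommGroup E] [NormedSpace ℝ E] (U : Set E)
    (A : E → Matrix (Fin m) (Fin m) ℝ) (hA : ∀ i j, ContDiffOn ℝ ∞ (fun p => A p i j) U) :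
    ContDiffOn ℝ ∞ (fun p => (A p).det) U := by
  simp only [Matrix.det_apply]
  refine ContDiffOn.sum fun σ _ => ?_
  refine ContDiffOn.const_smul _ ?_
  exact contDiffOn_prod fun i _ => hA _ _

theorem inv_smooth {m : ℕ} {E : Type} [NormedAddCommGroup E] [NormedSpace ℝ E] (U : Set E)
    (A : E → Matrix (Fin m) (Fin m) ℝ) (hA : ∀ i j, ContDiffOn ℝ ∞ (fun p => A p i j) U)
    (hu : ∀ p ∈ U, IsUnit (A p).det) (i j : Fin m) :
    ContDiffOn ℝ ∞ (fun p => (A p)⁻¹ i j) U := by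
  have h1 : ContDiffOn ℝ ∞ (fun p => ((A p).det)⁻¹) U :=
    (det_smooth U A hA).inv fun p hp => (hu p hp).ne_zero
  have h2 : ContDiffOn ℝ ∞ (fun p => (A p).adjugate i j) U := by
    simp only [Matrix.adjugate_apply]
    apply det_smooth
    intro k l
    by_cases hk : k = j
    · subst hk
      simp only [Matrix.updateRow_self]
      exact contDiffOn_const
    · simp only [Matrix.updateRow_ne hk]
      exact hA k l
  refine (h1.mul h2).congr fun p _ => ?_
  simp [Matrix.inv_def]

theorem exists_potential {n : ℕ} (U : Set (Fin n → ℝ)) (hU : IsOpen U)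
    (b : (Fin n → ℝ) → Fin n → ℝ)
    (hb_smooth : ∀ i, ContDiffOn ℝ ∞ (fun p => b p i) U)
    (hb_closed : ∀ p ∈ U, ∀ i j, pd i (fun q => b q j) p = pd j (fun q => b q i) p)
    (p : Fin n → ℝ) (hp : p ∈ U) :
    ∃ (W : Set (Fin n → ℝ)) (f : (Fin n → ℝ) → ℝ) (θ : (Fin n → ℝ) → (Fin n → ℝ) →L[ℝ] ℝ),
      IsOpen W ∧ p ∈ W ∧ W ⊆ U ∧ ContDiffOn ℝ ∞ f W ∧ (∀ q x, θ q x = ∑ i, b q i * x i) ∧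
      ∀ q ∈ W, HasFDerivAt f (θ q) q := by
  obtain ⟨ε, hε, hball⟩ := Metric.isOpen_iff.1 hU p hp
  let pr : Fin n → ((Fin n → ℝ) →L[ℝ] ℝ) := fun i => ContinuousLinearMap.proj i
  let θ : (Fin n → ℝ) → (Fin n → ℝ) →L[ℝ] ℝ := fun q => ∑ i, b q i • pr i
  have hθ : ContDiffOn ℝ ∞ θ U :=
    ContDiffOn.sum fun i _ => (hb_smooth i).smul contDiffOn_const
  have hθa : ∀ q x, θ q x = ∑ i, b q i * x i := by
    intro q x
    simp [θ, pr]
  have hbd : ∀ q ∈ U, ∀ i, HasFDerivAt (fun q => b q i) (fderiv ℝ (fun q => b q i) q) q :=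
    fun q hq i => (((hb_smooth i).contDiffAt (hU.mem_nhds hq)).differentiableAt
      (by simp)).hasFDerivAt
  have hexp : ∀ q i x, fderiv ℝ (fun q => b q i) q x = ∑ j, x j * pd j (fun q => b q i) q := by
    intro q i x
    have hx : x = ∑ j, x j • (Pi.single j 1 : Fin n → ℝ) := by
      funext k
      simp [Finset.sum_apply, Pi.single_apply]
    conv_lhs => rw [hx]
    simp only [pd, map_sum, map_smul, smul_eq_mul]
  have hθd : ∀ q ∈ U, ∀ x y, fderiv ℝ θ q x y = ∑ i, ∑ j, x j * pd j (fun q => b q i) q * y i := by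
    intro q hq x y
    have h1 : HasFDerivAt θ (∑ i, (fderiv ℝ (fun q => b q i) q).smulRight (pr i)) q :=
      HasFDerivAt.fun_sum fun i _ => (hbd q hq i).smul_const (pr i)
    rw [h1.fderiv]
    simp [pr, hexp, Finset.sum_mul]
  obtain ⟨f, hf⟩ := (convex_ball p ε).exists_forall_hasFDerivAt_of_fderiv_symmetric isOpen_ball
    ((hθ.mono hball).differentiableOn (by simp)) (by
      intro q hq x y
      rw [hθd q (hball hq), hθd q (hball hq), Finset.sum_comm]
      refine Finset.sum_congr rfl fun i _ => Finset.sum_congr rfl fun j _ => ?_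
      rw [hb_closed q (hball hq) i j]
      ring)
  refine ⟨ball p ε, f, θ, isOpen_ball, mem_ball_self hε, hball, ?_, hθa, hf⟩
  rw [contDiffOn_infty_iff_fderiv_of_isOpen isOpen_ball]
  refine ⟨fun q hq => (hf q hq).differentiableAt.differentiableWithinAt, ?_⟩
  exact (hθ.mono hball).congr fun q hq => (hf q hq).fderiv

/-- The pointwise linear algebra. -/
theorem kundt_algebra {n : ℕ} (hn : 3 ≤ n) (A J K : Matrix (Fin n) (Fin n) ℝ)
    (X b : Fin n → ℝ) (hA : A.IsSymm) (hAd : IsUnit A.det) (hJK : J * K = 1)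
    (hJX : J *ᵥ X = Pi.single (vIdx hn) 1) (hAX : A *ᵥ X = -b) (hJb : ∀ j, J (uIdx hn) j = b j) :
    (Kᵀ * A * K).IsSymm ∧
    (∀ i, (Kᵀ * A * K) i (vIdx hn) = if i = uIdx hn then -1 else 0) ∧
    (∀ i, (∑ j, K j i * b j) = if i = uIdx hn then 1 else 0) ∧
    IsUnit (Matrix.det (Matrix.of fun i' j' : Fin (n - 2) =>
      (Kᵀ * A * K) (embIdx i') (embIdx j'))) := by
  have hKJ : K * J = 1 := mul_eq_one_comm.1 hJK
  have hsym : (Kᵀ * A * K).IsSymm := by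
    unfold Matrix.IsSymm
    rw [Matrix.transpose_mul, Matrix.transpose_mul, Matrix.transpose_transpose, hA.eq,
      Matrix.mul_assoc]
  have hKb : ∀ i, (∑ j, K j i * b j) = if i = uIdx hn then 1 else 0 := by
    intro i
    have := congrFun (congrFun hJK (uIdx hn)) i
    rw [Matrix.mul_apply, Matrix.one_apply] at this
    simp only [hJb] at this
    rw [← (if_congr (eq_comm (a := uIdx hn) (b := i)) rfl rfl : (if uIdx hn = i then (1:ℝ) else 0) = _),
      ← this]
    exact Finset.sum_congr rfl fun j _ => mul_comm _ _
  have hKv : K *ᵥ Pi.single (vIdx hn) 1 = X := by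
    rw [← hJX, Matrix.mulVec_mulVec, hKJ, Matrix.one_mulVec]
  have hcol : ∀ i, (Kᵀ * A * K) i (vIdx hn) = if i = uIdx hn then -1 else 0 := by
    intro i
    have h1 : ((Kᵀ * A * K) *ᵥ Pi.single (vIdx hn) 1) i = (Kᵀ * A * K) i (vIdx hn) := by
      simp
    rw [← h1, ← Matrix.mulVec_mulVec, hKv, ← Matrix.mulVec_mulVec, hAX, Matrix.mulVec_neg]
    have h2 : (Kᵀ *ᵥ b) i = ∑ j, K j i * b j := rfl
    rw [Pi.neg_apply, h2, hKb]
    split_ifs <;> simp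
  refine ⟨hsym, hcol, hKb, ?_⟩
  have hdet : (Kᵀ * A * K).det ≠ 0 := by
    rw [Matrix.det_mul, Matrix.det_mul, Matrix.det_transpose]
    have : K.det ≠ 0 := by
      intro h
      have := congrArg Matrix.det hJK
      rw [Matrix.det_mul, h] at this
      simp at this
    exact mul_ne_zero (mul_ne_zero this hAd.ne_zero) this
  generalize Kᵀ * A * K = M at hsym hcol hdet
  obtain ⟨m, rfl⟩ : ∃ m, n = m + 2 := ⟨n - 2, by omega⟩
  have hv1 : (vIdx hn : Fin (m + 2)) = 1 := rfl
  have hu0 : (uIdx hn : Fin (m + 2)) = 0 := rfl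
  rw [hv1, hu0] at hcol
  rw [isUnit_iff_ne_zero]
  intro h0
  obtain ⟨w, hw0, hw⟩ := Matrix.exists_mulVec_eq_zero_iff.2 h0
  change Fin m → ℝ at w
  have hw' : ∀ i : Fin m, ∑ j : Fin m, M i.succ.succ j.succ.succ * w j = 0 := fun i =>
    congrFun hw i
  apply hdet
  apply Matrix.exists_mulVec_eq_zero_iff.1
  let c : ℝ := ∑ j : Fin m, M 0 j.succ.succ * w j
  let z : Fin (m + 2) → ℝ := Fin.cons 0 (Fin.cons c w)
  have hrow : ∀ i, M 1 i = if i = 0 then -1 else 0 := fun i => by rw [← hcol i]; exact hsym.apply _ _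
  refine ⟨z, ?_, ?_⟩
  · intro hz
    apply hw0
    funext i
    exact congrFun hz i.succ.succ
  · funext i
    have hexp : (M *ᵥ z) i = M i 1 * c + ∑ j : Fin m, M i j.succ.succ * w j := by
      change ∑ j, M i j * z j = _
      rw [Fin.sum_univ_succ, Fin.sum_univ_succ]
      simp [z]
    rw [hexp]
    refine Fin.cases ?_ (fun i => Fin.cases ?_ (fun i => ?_) i) i
    · simp [hcol, c]
    · have : ∀ j : Fin m, M 1 j.succ.succ = 0 := fun j => by
        rw [hrow]; simp
      simp [hcol, this]
    · rw [hw' i, hcol]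
      simp

theorem stmt3 {n : ℕ} (hn : 3 ≤ n) (U : Set (Fin n → ℝ)) (hU : IsOpen U)
    (a : (Fin n → ℝ) → Matrix (Fin n) (Fin n) ℝ)
    (ha_smooth : ∀ i j, ContDiffOn ℝ (⊤ : ℕ∞) (fun p => a p i j) U)
    (ha_symm : ∀ p ∈ U, (a p).IsSymm) (ha_inv : ∀ p ∈ U, IsUnit (a p).det)
    (b : (Fin n → ℝ) → Fin n → ℝ)
    (hb_smooth : ∀ i, ContDiffOn ℝ (⊤ : ℕ∞) (fun p => b p i) U)
    (hb_ne : ∀ p ∈ U, b p ≠ 0)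
    (hb_closed : ∀ p ∈ U, ∀ i j, pd i (fun q => b q j) p = pd j (fun q => b q i) p)
    (hb_null : ∀ p ∈ U, ∑ k, ∑ l, (a p)⁻¹ k l * b p k * b p l = 0) :
    ∀ p ∈ U, ∃ V : Set (Fin n → ℝ), IsOpen V ∧ p ∈ V ∧ V ⊆ U ∧
      ∃ φ ψ : (Fin n → ℝ) → (Fin n → ℝ),
        ContDiffOn ℝ (⊤ : ℕ∞) φ V ∧ Set.InjOn φ V ∧ IsOpen (φ '' V) ∧
        ContDiffOn ℝ (⊤ : ℕ∞) ψ (φ '' V) ∧ (∀ q ∈ V, ψ (φ q) = q) ∧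
        ∃ (H : (Fin n → ℝ) → ℝ) (W : (Fin n → ℝ) → Fin n → ℝ)
          (h : (Fin n → ℝ) → Fin n → Fin n → ℝ),
          ContDiffOn ℝ (⊤ : ℕ∞) H (φ '' V) ∧
          (∀ i, ContDiffOn ℝ (⊤ : ℕ∞) (fun q => W q i) (φ '' V)) ∧
          (∀ i j, ContDiffOn ℝ (⊤ : ℕ∞) (fun q => h q i j) (φ '' V)) ∧
          ∀ q ∈ V, ∀ J : Matrix (Fin n) (Fin n) ℝ,
            J = Matrix.of (fun i j => fderiv ℝ (fun r => φ r i) q (Pi.single j 1)) →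
            IsKundt hn (J⁻¹ᵀ * a q * J⁻¹) (H (φ q)) (W (φ q)) (h (φ q)) ∧
            (∀ i j, h (φ q) i j = h (φ q) j i) ∧
            IsUnit (Matrix.det
              (Matrix.of fun i' j' : Fin (n - 2) => h (φ q) (embIdx i') (embIdx j'))) ∧
            (∀ i, (∑ j, J⁻¹ j i * b q j) = if i = uIdx hn then 1 else 0) := by
  intro p hp
  set u := uIdx hn with hu
  set v := vIdx hn with hv
  have huv : u ≠ v := by
    rw [hu, hv]; simp [uIdx, vIdx]
  obtain ⟨W₁, f, θ, hW₁, hpW₁, hW₁U, hfsm, hθa, hfd⟩ :=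
    exists_potential U hU b hb_smooth hb_closed p hp
  let X : (Fin n → ℝ) → (Fin n → ℝ) := fun q => -((a q)⁻¹ *ᵥ b q)
  have hXsm : ContDiffOn ℝ ∞ X U := by
    rw [contDiffOn_pi]
    intro i
    change ContDiffOn ℝ ∞ (fun q => -(∑ j, (a q)⁻¹ i j * b q j)) U
    exact (ContDiffOn.sum fun j _ =>
      (inv_smooth U a ha_smooth ha_inv i j).mul (hb_smooth j)).neg
  have haX : ∀ q ∈ U, a q *ᵥ X q = -b q := by
    intro q hq
    simp only [X]
    rw [Matrix.mulVec_neg, Matrix.mulVec_mulVec, Matrix.mul_nonsing_inv _ (ha_inv q hq),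
      Matrix.one_mulVec]
  have hθX : ∀ q ∈ U, θ q (X q) = 0 := by
    intro q hq
    have h0 := hb_null q hq
    rw [hθa]
    have : ∀ i, b q i * X q i = -∑ l, (a q)⁻¹ i l * b q i * b q l := by
      intro i
      change b q i * (-(∑ j, (a q)⁻¹ i j * b q j)) = _
      rw [mul_neg, Finset.mul_sum]
      congr 1
      exact Finset.sum_congr rfl fun j _ => by ring
    simp only [this, Finset.sum_neg_distrib, h0, neg_zero]
  have hXp : X p ≠ 0 := by
    intro h
    have := haX p hp
    rw [h, Matrix.mulVec_zero] at this
    exact hb_ne p hp (neg_eq_zero.1 this.symm)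
  have hθs : ∀ q j, θ q (Pi.single j 1) = b q j := by
    intro q j
    rw [hθa]
    simp [Pi.single_apply]
  have hθp : θ p ≠ 0 := by
    intro h
    apply hb_ne p hp
    funext j
    rw [← hθs p j, h]; rfl
  obtain ⟨M, hMX, hMu⟩ := exists_adapted u v huv (θ p) hθp (X p) hXp (hθX p hp)
  obtain ⟨χ, W₂, hW₂, hpW₂, hW₂W₁, hχsm, hχp, hχX⟩ :=
    flow_box v X W₁ hW₁ (hXsm.mono hW₁U) p hpW₁ M hMX
  let φ : (Fin n → ℝ) → (Fin n → ℝ) := fun q i => if i = u then f q else χ q i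
  have hφsm : ContDiffOn ℝ ∞ φ W₂ := by
    rw [contDiffOn_pi]
    intro i
    by_cases hi : i = u
    · simp only [φ, hi, if_true]
      exact hfsm.mono hW₂W₁
    · simp only [φ, hi, if_false]
      exact (contDiffOn_pi.1 hχsm) i
  have hχd : ∀ q ∈ W₂, HasFDerivAt χ (fderiv ℝ χ q) q := fun q hq =>
    ((hχsm.contDiffAt (hW₂.mem_nhds hq)).differentiableAt (by simp)).hasFDerivAt
  let Dφ : (Fin n → ℝ) → (Fin n → ℝ) →L[ℝ] (Fin n → ℝ) := fun q =>
    ContinuousLinearMap.pi fun i =>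
      if i = u then θ q else (ContinuousLinearMap.proj i).comp (fderiv ℝ χ q)
  have hφd : ∀ q ∈ W₂, HasFDerivAt φ (Dφ q) q := by
    intro q hq
    rw [hasFDerivAt_pi]
    intro i
    by_cases hi : i = u
    · simp only [φ, hi, if_true]
      exact hfd q (hW₂W₁ hq)
    · simp only [φ, hi, if_false]
      exact (hasFDerivAt_pi'.1 (hχd q hq)) i
  have hDu : ∀ q x, Dφ q x u = θ q x := by
    intro q x; simp [Dφ]
  have hDi : ∀ q x i, i ≠ u → Dφ q x i = fderiv ℝ χ q x i := by
    intro q x i hi; simp [Dφ, hi]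
  have hφp : HasFDerivAt φ (M : (Fin n → ℝ) →L[ℝ] (Fin n → ℝ)) p := by
    refine (hφd p hpW₂).congr_fderiv ?_
    refine ContinuousLinearMap.ext fun x => ?_
    funext i
    by_cases hi : i = u
    · rw [hi, hDu]; exact (hMu x).symm
    · rw [hDi _ _ _ hi, hχp.fderiv]
  obtain ⟨e, he, hpe, heW, hesm, hed⟩ := smooth_inv φ W₂ hW₂ hφsm p hpW₂ M hφp
  have himg : φ '' e.source = e.target := by rw [← he]; exact e.image_source_eq_target
  have hsub : e.source ⊆ U := fun q hq => hW₁U (hW₂W₁ (heW hq))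
  let K : (Fin n → ℝ) → Matrix (Fin n) (Fin n) ℝ := fun y =>
    Matrix.of fun i j => fderiv ℝ e.symm y (Pi.single j 1) i
  let N : (Fin n → ℝ) → Matrix (Fin n) (Fin n) ℝ := fun y => (K y)ᵀ * a (e.symm y) * K y
  have hKsm : ∀ i j, ContDiffOn ℝ ∞ (fun y => K y i j) e.target := by
    intro i j
    have h1 : ContDiffOn ℝ ∞ (fderiv ℝ e.symm) e.target :=
      ((contDiffOn_infty_iff_fderiv_of_isOpen e.open_target).1 hesm).2
    have h2 := h1.clm_apply (contDiffOn_const (c := (Pi.single j 1 : Fin n → ℝ)))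
    exact contDiffOn_pi.1 h2 i
  have hasm : ∀ i j, ContDiffOn ℝ ∞ (fun y => a (e.symm y) i j) e.target := fun i j =>
    (ha_smooth i j).comp hesm fun y hy => hsub (e.map_target hy)
  have hNsm : ∀ i j, ContDiffOn ℝ ∞ (fun y => N y i j) e.target := by
    intro i j
    simp only [N, Matrix.mul_apply, Matrix.transpose_apply]
    exact ContDiffOn.sum fun k _ => (ContDiffOn.sum fun l _ =>
      (hKsm _ _).mul (hasm _ _)).mul (hKsm _ _)
  refine ⟨e.source, e.open_source, hpe, hsub, φ, e.symm, hφsm.mono heW, ?_, ?_, ?_, ?_,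
    fun y => N y u u, fun y i => 2 * N y u i, fun y i j => N y i j, ?_, ?_, ?_, ?_⟩
  · rw [← he]; exact e.injOn
  · rw [himg]; exact e.open_target
  · rw [himg]; exact hesm
  · intro q hq; rw [← he]; exact e.left_inv hq
  · rw [himg]; exact hNsm _ _
  · intro i; rw [himg]; exact contDiffOn_const.mul (hNsm _ _)
  · intro i j; rw [himg]; exact hNsm _ _
  · intro q hq J hJ
    have hqU := hsub hq
    have hqW := heW hq
    obtain ⟨g, hg⟩ := hed q hq
    have hsq : e.symm (φ q) = q := by rw [← he]; exact e.left_inv hq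
    have hφq : φ q ∈ e.target := by rw [← himg]; exact mem_image_of_mem _ hq
    have hsd : HasFDerivAt e.symm (g.symm : (Fin n → ℝ) →L[ℝ] (Fin n → ℝ)) (φ q) :=
      e.hasFDerivAt_symm hφq (by rw [he, hsq]; exact hg)
    have hgD : ∀ x, g x = Dφ q x := fun x => by
      rw [← (hg.unique (hφd q hqW))]; rfl
    have hJg : J = LinearMap.toMatrix' (g.toLinearEquiv : (Fin n → ℝ) →ₗ[ℝ] (Fin n → ℝ)) := by
      rw [hJ]
      ext i j
      rw [LinearMap.toMatrix'_apply, Matrix.of_apply, ((hasFDerivAt_pi'.1 hg) i).fderiv]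
      rfl
    have hKg : K (φ q) =
        LinearMap.toMatrix' (g.symm.toLinearEquiv : (Fin n → ℝ) →ₗ[ℝ] (Fin n → ℝ)) := by
      ext i j
      simp only [K]
      rw [LinearMap.toMatrix'_apply, Matrix.of_apply, hsd.fderiv]
      rfl
    have hJK : J * K (φ q) = 1 := by
      rw [hJg, hKg, ← LinearMap.toMatrix'_comp, ← LinearMap.toMatrix'_id]
      congr 1
      ext1 x
      simp
    have hJinv : J⁻¹ = K (φ q) := Matrix.inv_eq_right_inv hJK
    have hJX : J *ᵥ X q = Pi.single (vIdx hn) 1 := by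
      rw [hJg, LinearMap.toMatrix'_mulVec]
      change g (X q) = _
      rw [hgD]
      funext i
      by_cases hi : i = u
      · rw [hi, hDu, hθX q hqU]
        rw [← hv, Pi.single_eq_of_ne huv]
      · rw [hDi _ _ _ hi, hχX q hqW]
    have hJb : ∀ j, J (uIdx hn) j = b q j := by
      intro j
      rw [hJg, LinearMap.toMatrix'_apply]
      change g (Pi.single j 1) u = _
      rw [hgD, hDu, hθs]
    obtain ⟨h1, h2, h3, h4⟩ := kundt_algebra hn (a q) J (K (φ q)) (X q) (b q) (ha_symm q hqU)
      (ha_inv q hqU) hJK hJX (haX q hqU) hJb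
    have hN : N (φ q) = (K (φ q))ᵀ * a q * K (φ q) := by simp only [N, hsq]
    rw [hJinv]
    rw [← hN] at h1 h2 h4 ⊢
    have h2' : ∀ i, N (φ q) (vIdx hn) i = if i = uIdx hn then -1 else 0 := fun i => by
      rw [← h2 i]; exact h1.apply _ _
    refine ⟨⟨rfl, ?_, ?_, ?_, ?_, ?_⟩, ?_, h4, h3⟩
    · rw [h2, if_pos rfl]
    · rw [h2', if_pos rfl]
    · rw [h2, if_neg huv.symm]
    · intro i hi
      have hiu : i ≠ uIdx hn := by
        intro h; rw [h] at hi; simp [uIdx] at hi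
      refine ⟨?_, ?_, ?_, ?_⟩
      · simp only; rw [← hu]; ring
      · simp only; rw [← hu, ← h1.apply]; ring
      · rw [h2', if_neg hiu]
      · rw [h2, if_neg hiu]
    · intro i j _ _; rfl
    · intro i j; exact (h1.apply _ _).symm

end
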